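/- arXiv:2103.13695 — 3 statements merged into one kernel-verified Lean document; each statement's English description precedes it below -/
import Mathlib

section
/- Let n ≥ 0 and x, y ∈ G. Then π^n_{G,x} ∘ ν^n_{G,x} is the identity of C^n(C_G(x), kx); and if x and y are not conjugate in G, then π^n_{G,x} ∘ ν^n_{G,y} = 0. Hence, for a set X of representatives of the conjugacy classes of G, (⊕_{x∈X} π^n_{G,x}) ∘ (⊕_{x∈X} ν^n_{G,x}) is the identity of ⊕_{x∈X} C^n(C_G(x), kx). -/
/- Common setup: twisted group algebras modelled on their canonical basis.
An element of the twisted group algebra `k_αG` is modelled as a function `G → k`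
(its coordinates in the basis `{ḡ : g ∈ G}`), and a Hochschild `n`-cochain
`Hom_k((k_αG)^{⊗n}, M)` is modelled by its values on basis tensors, i.e. as a
function `(Fin n → G) → M`.  Similarly a group cochain `C^n(H, A)` is a function
`(Fin n → H) → A`; the one-dimensional module `k x̄` is modelled as `k` with the
action of `h` given by multiplication by the character `χ(h) = α(h,x)·α(x,h)⁻¹`. -/

namespace TwistedSym

section Defs

variable {k : Type*} [CommRing k] {G : Type*} [Group G] [DecidableEq G]
variable {M : Type*} [AddCommGroup M] [Module k M]
variable {H : Type*} [Group H]
variable {A : Type*} [AddCommGroup A] [DistribMulAction H A]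

/-- The 2-cocycle condition `α(x,yz)α(y,z) = α(xy,z)α(x,y)`. -/
def IsCocycle (α : G → G → kˣ) : Prop :=
  ∀ x y z : G, α x (y * z) * α y z = α (x * y) z * α x y

/-- Normalization `α(1,x) = α(x,1) = 1`. -/
def IsNormalized (α : G → G → kˣ) : Prop :=
  ∀ x : G, α 1 x = 1 ∧ α x 1 = 1

/-- `(L, R)` encode a `(k_αG, k_αG)`-bimodule structure on the `k`-module `M`:
`L g` is left multiplication by the basis element `ḡ` and `R g` is right
multiplication by `ḡ`. -/
def IsBimodule (α : G → G → kˣ) (L R : G → M →ₗ[k] M) : Prop :=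
  (∀ m : M, L 1 m = m) ∧ (∀ m : M, R 1 m = m) ∧
  (∀ (g h : G) (m : M), L g (L h m) = (α g h : k) • L (g * h) m) ∧
  (∀ (g h : G) (m : M), R h (R g m) = (α g h : k) • R (g * h) m) ∧
  (∀ (g h : G) (m : M), L g (R h m) = R h (L g m))

/-- The tuple of group elements appearing in the action of the transposition
`σ_{i0+1} = (i0+1, i0+2)` on `n`-cochains (0-indexed `i0 : Fin n`):
position `i0 - 1` gets `g_{i0-1}·g_{i0}`, position `i0` gets `g_{i0}⁻¹` and
position `i0 + 1` gets `g_{i0}·g_{i0+1}` (when these positions exist). -/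
def swapTuple {n : ℕ} (i0 : Fin n) (g : Fin n → H) : Fin n → H := fun j =>
  if (j : ℕ) + 1 = (i0 : ℕ) then g j * g i0
  else if j = i0 then (g i0)⁻¹
  else if (j : ℕ) = (i0 : ℕ) + 1 then g i0 * g j
  else g j

/-- The action of the transposition `σ_{i0+1} = (i0+1,i0+2) ∈ Σ_{n+1}` on Hochschild
`n`-cochains of the twisted group algebra `k_αG` with coefficients in the bimodule `M`.
All the `α`-scalars come from rewriting products and inverses of basis elements in
terms of basis elements: `ḡ·h̄ = α(g,h)·(gh)‾` and `ḡ⁻¹ = α(g,g⁻¹)⁻¹·(g⁻¹)‾`. -/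
def hSigma (α : G → G → kˣ) (L R : G → M →ₗ[k] M) {n : ℕ} (i0 : Fin n)
    (φ : (Fin n → G) → M) : (Fin n → G) → M := fun g =>
  -(((if 0 < (i0 : ℕ) then
        (α (g ⟨(i0 : ℕ) - 1, lt_of_le_of_lt (Nat.sub_le _ _) i0.isLt⟩) (g i0) : k) else 1) *
     (((α (g i0) (g i0)⁻¹)⁻¹ : kˣ) : k) *
     (if h : (i0 : ℕ) + 1 < n then (α (g i0) (g ⟨(i0 : ℕ) + 1, h⟩) : k) else 1)) •
    (if (i0 : ℕ) = 0 then
        L (g i0) (if (i0 : ℕ) + 1 = n then R (g i0) (φ (swapTuple i0 g)) else φ (swapTuple i0 g))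
      else (if (i0 : ℕ) + 1 = n then R (g i0) (φ (swapTuple i0 g)) else φ (swapTuple i0 g))))

/-- Staic's action of the transposition `σ_{i0+1} ∈ Σ_{n+1}` on group `n`-cochains
with values in an `H`-module `A`. -/
def gSigma {n : ℕ} (i0 : Fin n) (ψ : (Fin n → H) → A) : (Fin n → H) → A := fun h =>
  -(if (i0 : ℕ) = 0 then h i0 • ψ (swapTuple i0 h) else ψ (swapTuple i0 h))

/-- Staic's action of the transposition `σ_{i0+1} ∈ Σ_{n+1}` on group `n`-cochains
with values in the rank-one module `k` on which `H` acts through the character `χ`. -/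
def cSigma (χ : H → k) {n : ℕ} (i0 : Fin n) (ψ : (Fin n → H) → k) : (Fin n → H) → k := fun h =>
  -(if (i0 : ℕ) = 0 then χ (h i0) * ψ (swapTuple i0 h) else ψ (swapTuple i0 h))

/-- The `(n+1)`-tuple `g` with entries at positions `j, j+1` multiplied together. -/
def mergeAt {n : ℕ} (g : Fin (n + 1) → H) (j : Fin n) : Fin n → H := fun l =>
  if (l : ℕ) < (j : ℕ) then g (Fin.castSucc l)
  else if l = j then g (Fin.castSucc l) * g (Fin.succ l)
  else g (Fin.succ l)

/-- The Hochschild differential `δ^n` for the twisted group algebra `k_αG` with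
coefficients in the bimodule `M`, written on basis tensors (the scalar
`α(g_j, g_{j+1})` comes from `ḡ_j·ḡ_{j+1} = α(g_j,g_{j+1})·(g_jg_{j+1})‾`). -/
def hDiff (α : G → G → kˣ) (L R : G → M →ₗ[k] M) {n : ℕ}
    (φ : (Fin n → G) → M) : (Fin (n + 1) → G) → M := fun g =>
  L (g 0) (φ fun j => g j.succ)
    + ∑ j : Fin n, ((-1 : ℤ) ^ ((j : ℕ) + 1)) •
        ((α (g j.castSucc) (g j.succ) : k) • φ (mergeAt g j))
    + ((-1 : ℤ) ^ (n + 1)) • R (g (Fin.last n)) (φ fun j => g j.castSucc)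

/-- The group cohomology differential `∂^n` for cochains on `H` with values in the
`H`-module `A`. -/
def gDiff {n : ℕ} (ψ : (Fin n → H) → A) : (Fin (n + 1) → H) → A := fun h =>
  h 0 • ψ (fun j => h j.succ)
    + ∑ j : Fin n, ((-1 : ℤ) ^ ((j : ℕ) + 1)) • ψ (mergeAt h j)
    + ((-1 : ℤ) ^ (n + 1)) • ψ (fun j => h j.castSucc)

/-- The group cohomology differential `∂^n` for cochains on `H` with values in the
rank-one module `k` on which `H` acts through the character `χ`. -/
def cDiff (χ : H → k) {n : ℕ} (ψ : (Fin n → H) → k) : (Fin (n + 1) → H) → k := fun h =>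
  χ (h 0) * ψ (fun j => h j.succ)
    + ∑ j : Fin n, ((-1 : ℤ) ^ ((j : ℕ) + 1)) • ψ (mergeAt h j)
    + ((-1 : ℤ) ^ (n + 1)) • ψ (fun j => h j.castSucc)

/-- Left multiplication by the basis element `ḡ` on `k_αG` (modelled as `G → k`). -/
def Lmul (α : G → G → kˣ) (g : G) : (G → k) →ₗ[k] (G → k) where
  toFun a := fun y => (α g (g⁻¹ * y) : k) * a (g⁻¹ * y)
  map_add' a b := by funext y; simp [mul_add]
  map_smul' c a := by funext y; simp [smul_eq_mul]; ring

/-- Right multiplication by the basis element `ḡ` on `k_αG` (modelled as `G → k`). -/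
def Rmul (α : G → G → kˣ) (g : G) : (G → k) →ₗ[k] (G → k) where
  toFun a := fun y => (α (y * g⁻¹) g : k) * a (y * g⁻¹)
  map_add' a b := by funext y; simp [mul_add]
  map_smul' c a := by funext y; simp [smul_eq_mul]; ring

/-- Iterated right multiplication: `rmuls α [g₁,…,gₙ] v = v·ḡ₁·…·ḡₙ`. -/
def rmuls (α : G → G → kˣ) (l : List G) (v : G → k) : G → k :=
  l.foldl (fun w g => Rmul α g w) v

/-- Iterated right multiplication by inverses of basis elements:
`rinvs α [h₁,…,hₙ] v = v·h̄ₙ⁻¹·…·h̄₁⁻¹`, using `h̄⁻¹ = α(h,h⁻¹)⁻¹·(h⁻¹)‾`. -/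
def rinvs (α : G → G → kˣ) (l : List G) (v : G → k) : G → k :=
  l.foldr (fun h w => (((α h h⁻¹)⁻¹ : kˣ) : k) • Rmul α h⁻¹ w) v

/-- The character through which `h ∈ C_G(x)` acts on the module `k x̄`:
`χ(h) = α(h,x)·α(x,h)⁻¹`. -/
def chi (α : G → G → kˣ) (x : G) : G → k := fun h =>
  (α h x : k) * (((α x h)⁻¹ : kˣ) : k)

/-- The map `π^n_{G,x,α} : C^n(k_αG, k_αG) → C^n(C_G(x), k x̄)`: the value on
`(h₁,…,hₙ)` is the coefficient of the basis element `x̄` in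
`φ(h̄₁⊗…⊗h̄ₙ)·h̄ₙ⁻¹·…·h̄₁⁻¹` (identifying `k x̄` with `k`). -/
def piC (α : G → G → kˣ) (x : G) {n : ℕ} (φ : (Fin n → G) → (G → k)) :
    (Fin n → Subgroup.centralizer ({x} : Set G)) → k := fun h =>
  rinvs α (List.ofFn fun i => (h i : G)) (φ fun i => (h i : G)) x

/-- The same map as `piC` for a central element `x`, in which case `C_G(x) = G`:
`π^n_{G,x,α} : C^n(k_αG, k_αG) → C^n(G, k x̄)`. -/
def piZ (α : G → G → kˣ) (x : G) {n : ℕ} (φ : (Fin n → G) → (G → k)) :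
    (Fin n → G) → k := fun h =>
  rinvs α (List.ofFn h) (φ h) x

/-- The map `ν^n_{G,x,α} : C^n(G, k x̄) → C^n(k_αG, k_αG)` for `x ∈ Z(G)`:
`ψ ↦ (ḡ₁⊗…⊗ḡₙ ↦ ψ(g₁,…,gₙ)·x̄·ḡ₁·…·ḡₙ)` (identifying `k x̄` with `k`). -/
def nuZ (α : G → G → kˣ) (x : G) {n : ℕ} (ψ : (Fin n → G) → k) :
    (Fin n → G) → (G → k) := fun g =>
  ψ g • rmuls α (List.ofFn g) (Pi.single x 1)

/-- Iteration of the index map of a coset decomposition along a list of group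
elements: `chainIdx idx j [g₁,…,gᵢ]` is the index `s_j^i`. -/
def chainIdx {m : ℕ} (idx : Fin m → G → Fin m) (j : Fin m) : List G → Fin m
  | [] => j
  | a :: l => chainIdx idx (idx j a) l

/-- The map `ν^n_{G,x} : C^n(C_G(x), kx) → C^n(kG, kG)` for the (untwisted) group
algebra, relative to a right coset decomposition `G = ⋃ⱼ C_G(x)γⱼ`:
`ν(ψ)(g₁⊗…⊗gₙ) = Σⱼ ψ(h_{j,1},…,h_{j,n})·x⁻¹·xⱼ·g₁⋯gₙ` where
`xⱼ = γⱼ⁻¹xγⱼ`, the `h_{j,i} = rep (s_j^{i-1}) gᵢ ∈ C_G(x)` are determined by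
`γ_{s_j^{i-1}}·gᵢ = h_{j,i}·γ_{s_j^i}` and `kx` is identified with `k`. -/
def nuT (x : G) {m n : ℕ} (γ : Fin m → G) (idx : Fin m → G → Fin m)
    (rep : Fin m → G → G)
    (hrep : ∀ j a, rep j a ∈ Subgroup.centralizer ({x} : Set G))
    (ψ : (Fin n → Subgroup.centralizer ({x} : Set G)) → k) :
    (Fin n → G) → (G → k) := fun g =>
  ∑ j : Fin m,
    ψ (fun i => ⟨rep (chainIdx idx j ((List.ofFn g).take (i : ℕ))) (g i), hrep _ _⟩) •
      (Pi.single ((γ j)⁻¹ * x * γ j * (List.ofFn g).prod) (1 : k) : G → k)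

/-- `φ` is a Hochschild coboundary (for `n = 0` the coboundary space is `0`). -/
def IsHCoboundary (α : G → G → kˣ) (L R : G → M →ₗ[k] M) :
    ∀ {n : ℕ}, ((Fin n → G) → M) → Prop
  | 0, φ => φ = 0
  | _ + 1, φ => ∃ θ, φ = hDiff α L R θ

/-- `φ` is the Hochschild coboundary of a `Σ`-invariant cochain. -/
def IsHSCoboundary (α : G → G → kˣ) (L R : G → M →ₗ[k] M) :
    ∀ {n : ℕ}, ((Fin n → G) → M) → Prop
  | 0, φ => φ = 0
  | _ + 1, φ => ∃ θ, (∀ i0, hSigma α L R i0 θ = θ) ∧ φ = hDiff α L R θ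

/-- `ψ` is a group-cohomology coboundary (coefficients in `k` through `χ`). -/
def IsCCoboundary (χ : H → k) : ∀ {n : ℕ}, ((Fin n → H) → k) → Prop
  | 0, ψ => ψ = 0
  | _ + 1, ψ => ∃ θ, ψ = cDiff χ θ

/-- `ψ` is the coboundary of a `Σ`-invariant group cochain (coefficients through `χ`). -/
def IsCSCoboundary (χ : H → k) : ∀ {n : ℕ}, ((Fin n → H) → k) → Prop
  | 0, ψ => ψ = 0
  | _ + 1, ψ => ∃ θ, (∀ i0, cSigma χ i0 θ = θ) ∧ ψ = cDiff χ θ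

/-- `ψ` is a group-cohomology coboundary (coefficients in the `H`-module `A`). -/
def IsGCoboundary : ∀ {n : ℕ}, ((Fin n → H) → A) → Prop
  | 0, ψ => ψ = 0
  | _ + 1, ψ => ∃ θ, ψ = gDiff θ

/-- `ψ` is the coboundary of a `Σ`-invariant group cochain (coefficients in `A`). -/
def IsGSCoboundary : ∀ {n : ℕ}, ((Fin n → H) → A) → Prop
  | 0, ψ => ψ = 0
  | _ + 1, ψ => ∃ θ, (∀ i0, gSigma i0 θ = θ) ∧ ψ = gDiff θ

end Defs

section Orthogonality

theorem chainIdx_eq_self {S : Type*} {m : ℕ} {idx : Fin m → S → Fin m} {j : Fin m}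
    (l : List S)
    (hl : ∀ a ∈ l, idx j a = j) : chainIdx idx j l = j := by
  induction l with
  | nil => rfl
  | cons a l ih =>
    rw [chainIdx, hl a (by simp)]
    exact ih fun b hb => hl b (by simp [hb])

variable {k : Type*} [CommRing k] {G : Type*} [Group G]

theorem rinvs_one_apply (l : List G) (v : G → k) (y : G) :
    rinvs (fun _ _ => (1 : kˣ)) l v y = v (y * l.prod) := by
  induction l generalizing y with
  | nil => simp [rinvs]
  | cons h l ih =>
    have step : rinvs (fun _ _ => (1 : kˣ)) (h :: l) v y =
        rinvs (fun _ _ => (1 : kˣ)) l v (y * h) := by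
      simp [rinvs, Rmul]
    rw [step, ih, List.prod_cons, mul_assoc]

theorem piC_one_apply (x : G) {n : ℕ} (φ : (Fin n → G) → (G → k))
    (h : Fin n → Subgroup.centralizer ({x} : Set G)) :
    piC (fun _ _ => (1 : kˣ)) x φ h =
      φ (fun i => (h i : G)) (x * (List.ofFn fun i => (h i : G)).prod) :=
  rinvs_one_apply _ _ _

theorem piC_one_sum (x : G) {n : ℕ} {ι : Type*} (s : Finset ι)
    (φ : ι → (Fin n → G) → (G → k)) :
    piC (fun _ _ => (1 : kˣ)) x (∑ i ∈ s, φ i) =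
      ∑ i ∈ s, piC (fun _ _ => (1 : kˣ)) x (φ i) := by
  funext h
  simp only [piC_one_apply, Finset.sum_apply]

theorem piC_one_nuT_apply [DecidableEq G] (x y : G) {m n : ℕ} (γ : Fin m → G)
    (idx : Fin m → G → Fin m) (rep : Fin m → G → G)
    (hrep : ∀ j a, rep j a ∈ Subgroup.centralizer ({y} : Set G))
    (ψ : (Fin n → Subgroup.centralizer ({y} : Set G)) → k)
    (h : Fin n → Subgroup.centralizer ({x} : Set G)) :
    piC (fun _ _ => (1 : kˣ)) x (nuT y γ idx rep hrep ψ) h =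
      ∑ j : Fin m, if (γ j)⁻¹ * y * γ j = x then
        ψ (fun i => ⟨rep (chainIdx idx j ((List.ofFn fun i => (h i : G)).take (i : ℕ))) (h i),
          hrep _ _⟩) else 0 := by
  rw [piC_one_apply, nuT, Finset.sum_apply]
  refine Finset.sum_congr rfl fun j _ => ?_
  simp [Pi.single_apply, eq_comm]

theorem piC_one_nuT_of_not_isConj [DecidableEq G] {x y : G} (hxy : ¬ IsConj x y) {m n : ℕ}
    (γ : Fin m → G) (idx : Fin m → G → Fin m) (rep : Fin m → G → G)
    (hrep : ∀ j a, rep j a ∈ Subgroup.centralizer ({y} : Set G))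
    (ψ : (Fin n → Subgroup.centralizer ({y} : Set G)) → k) :
    piC (fun _ _ => (1 : kˣ)) x (nuT y γ idx rep hrep ψ) = 0 := by
  funext h
  rw [piC_one_nuT_apply]
  refine Finset.sum_eq_zero fun j _ => if_neg fun hj => hxy ?_
  refine isConj_iff.2 ⟨γ j, ?_⟩
  rw [← hj]
  group

theorem piC_one_nuT_self [DecidableEq G] (x : G) {m n : ℕ} (γ : Fin m → G)
    (idx : Fin m → G → Fin m) (rep : Fin m → G → G)
    (hrep : ∀ j a, rep j a ∈ Subgroup.centralizer ({x} : Set G)) {j₀ : Fin m} (hγ : γ j₀ = 1)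
    (hidx : ∀ j a, γ j * a = rep j a * γ (idx j a))
    (hcoset : ∀ g : G, ∃! j : Fin m, g * (γ j)⁻¹ ∈ Subgroup.centralizer ({x} : Set G))
    (ψ : (Fin n → Subgroup.centralizer ({x} : Set G)) → k) :
    piC (fun _ _ => (1 : kˣ)) x (nuT x γ idx rep hrep ψ) = ψ := by
  have eq_base : ∀ j, γ j ∈ Subgroup.centralizer ({x} : Set G) → j = j₀ := fun j hj =>
    (hcoset 1).unique (by simpa using hj) (by simp [hγ])
  have idx_base : ∀ a ∈ Subgroup.centralizer ({x} : Set G), idx j₀ a = j₀ := fun a ha => by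
    refine eq_base _ ?_
    have h := hidx j₀ a
    rw [hγ, one_mul] at h
    rwa [h, Subgroup.mul_mem_cancel_left _ (hrep _ _)] at ha
  have rep_base : ∀ a ∈ Subgroup.centralizer ({x} : Set G), rep j₀ a = a := fun a ha => by
    have h := hidx j₀ a
    rw [idx_base a ha, hγ, one_mul, mul_one] at h
    exact h.symm
  funext h
  rw [piC_one_nuT_apply, Finset.sum_eq_single j₀ _ (by simp), if_pos (by simp [hγ])]
  · congr 1
    funext i
    apply Subtype.ext
    rw [chainIdx_eq_self]
    · exact rep_base _ (h i).2
    intro a ha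
    obtain ⟨i', rfl⟩ := List.mem_ofFn.1 (List.mem_of_mem_take ha)
    exact idx_base _ (h i').2
  · refine fun j _ hj => if_neg fun hx => hj (eq_base j ?_)
    rw [Subgroup.mem_centralizer_singleton_iff]
    rw [mul_assoc, inv_mul_eq_iff_eq_mul] at hx
    exact hx.symm

end Orthogonality

/-- for the group algebra `kG`, `π^n_{G,x} ∘ ν^n_{G,x} = id`; if `x` and
`y` are not conjugate then `π^n_{G,x} ∘ ν^n_{G,y} = 0`; hence for a set `X` of
representatives of the conjugacy classes of `G`,
`(⊕_{x∈X} π^n_{G,x}) ∘ (⊕_{x∈X} ν^n_{G,x})` is the identity of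
`⊕_{x∈X} C^n(C_G(x), kx)`. -/
theorem piT_nuT_orthogonality
    {k : Type*} [CommRing k] {G : Type*} [Group G] [Fintype G] [DecidableEq G] {n : ℕ} :
    (∀ (x : G) (m : ℕ) (γ : Fin m → G) (idx : Fin m → G → Fin m) (rep : Fin m → G → G)
      (hrep : ∀ j a, rep j a ∈ Subgroup.centralizer ({x} : Set G))
      (hm : 0 < m), γ ⟨0, hm⟩ = 1 →
      (∀ j a, γ j * a = rep j a * γ (idx j a)) →
      (∀ g : G, ∃! j : Fin m, g * (γ j)⁻¹ ∈ Subgroup.centralizer ({x} : Set G)) →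
      ∀ ψ : (Fin n → Subgroup.centralizer ({x} : Set G)) → k,
        piC (fun _ _ => (1 : kˣ)) x (nuT x γ idx rep hrep ψ) = ψ) ∧
    (∀ (x y : G), ¬ IsConj x y →
      ∀ (m : ℕ) (γ : Fin m → G) (idx : Fin m → G → Fin m) (rep : Fin m → G → G)
      (hrep : ∀ j a, rep j a ∈ Subgroup.centralizer ({y} : Set G))
      (hm : 0 < m), γ ⟨0, hm⟩ = 1 →
      (∀ j a, γ j * a = rep j a * γ (idx j a)) →
      (∀ g : G, ∃! j : Fin m, g * (γ j)⁻¹ ∈ Subgroup.centralizer ({y} : Set G)) →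
      ∀ ψ : (Fin n → Subgroup.centralizer ({y} : Set G)) → k,
        piC (fun _ _ => (1 : kˣ)) x (nuT y γ idx rep hrep ψ) = 0) ∧
    (∀ (X : Finset G), (∀ g : G, ∃! x, x ∈ X ∧ IsConj x g) →
      ∀ (m : G → ℕ) (γ : ∀ x : G, Fin (m x) → G)
        (idx : ∀ x : G, Fin (m x) → G → Fin (m x)) (rep : ∀ x : G, Fin (m x) → G → G)
        (hrep : ∀ x j a, rep x j a ∈ Subgroup.centralizer ({x} : Set G))
        (hm : ∀ x, 0 < m x), (∀ x, γ x ⟨0, hm x⟩ = 1) →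
        (∀ x j a, γ x j * a = rep x j a * γ x (idx x j a)) →
        (∀ x g : G, ∃! j : Fin (m x), g * (γ x j)⁻¹ ∈ Subgroup.centralizer ({x} : Set G)) →
        ∀ ψf : ∀ x : G, (Fin n → Subgroup.centralizer ({x} : Set G)) → k,
          ∀ x ∈ X, piC (fun _ _ => (1 : kˣ)) x
            (∑ y ∈ X, nuT y (γ y) (idx y) (rep y) (hrep y) (ψf y)) = ψf x) := by
  refine ⟨fun x m γ idx rep hrep hm hγ hidx hcoset ψ =>
      piC_one_nuT_self x γ idx rep hrep hγ hidx hcoset ψ,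
    fun x y hxy m γ idx rep hrep _ _ _ _ ψ =>
      piC_one_nuT_of_not_isConj hxy γ idx rep hrep ψ, ?_⟩
  intro X hX m γ idx rep hrep hm hγ hidx hcoset ψf x hx
  rw [piC_one_sum, Finset.sum_eq_single_of_mem x hx fun y hy hyx =>
    piC_one_nuT_of_not_isConj (fun hxy => hyx ((hX y).unique ⟨hy, IsConj.refl y⟩ ⟨hx, hxy⟩))
      _ _ _ _ _]
  exact piC_one_nuT_self x _ _ _ _ (hγ x) (hidx x) (hcoset x) _

end TwistedSym
end

section
/- Let n ≥ 0. (a) For every x ∈ G, π^n_{G,x,α} maps Hochschild n-cocycles to group n-cocycles and Hochschild n-coboundaries to group n-coboundaries, hence induces a well-defined k-linear map π^n_{G,x,α} : HH^n(k_αG) → H^n(C_G(x), k x̄) on cohomology. (b) For every x ∈ Z(G), ν^n_{G,x,α} maps group n-cocycles to Hochschild n-cocycles and group n-coboundaries to Hochschild n-coboundaries, hence induces a well-defined k-linear map ν^n_{G,x,α} : H^n(G, k x̄) → HH^n(k_αG) on cohomology. -/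
/- Common setup: twisted group algebras modelled on their canonical basis.
An element of the twisted group algebra `k_αG` is modelled as a function `G → k`
(its coordinates in the basis `{ḡ : g ∈ G}`), and a Hochschild `n`-cochain
`Hom_k((k_αG)^{⊗n}, M)` is modelled by its values on basis tensors, i.e. as a
function `(Fin n → G) → M`.  Similarly a group cochain `C^n(H, A)` is a function
`(Fin n → H) → A`; the one-dimensional module `k x̄` is modelled as `k` with the
action of `h` given by multiplication by the character `χ(h) = α(h,x)·α(x,h)⁻¹`. -/

namespace TwistedSym

section ChainMaps

variable {k : Type*} [CommRing k] {G : Type*} [Group G]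
variable {α : G → G → kˣ}

theorem Rmul_one (hnorm : IsNormalized α) (v : G → k) : Rmul α 1 v = v := by
  funext y
  simp [Rmul, (hnorm y).2]

theorem Rmul_Rmul (hα : IsCocycle α) (g h : G) (v : G → k) :
    Rmul α h (Rmul α g v) = (α g h : k) • Rmul α (g * h) v := by
  funext y
  have key := congrArg (Units.val) (hα (y * h⁻¹ * g⁻¹) g h)
  simp only [Units.val_mul, inv_mul_cancel_right] at key
  simp only [Rmul, LinearMap.coe_mk, AddHom.coe_mk, Pi.smul_apply, smul_eq_mul, mul_inv_rev,
    ← mul_assoc] at key ⊢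
  rw [← key]
  ring

theorem Lmul_Rmul (hα : IsCocycle α) (g h : G) (v : G → k) :
    Lmul α g (Rmul α h v) = Rmul α h (Lmul α g v) := by
  funext y
  have key := congrArg (Units.val) (hα g (g⁻¹ * y * h⁻¹) h)
  simp only [Units.val_mul, inv_mul_cancel_right] at key
  simp only [Rmul, Lmul, LinearMap.coe_mk, AddHom.coe_mk, ← mul_assoc, mul_inv_cancel, one_mul]
    at key ⊢
  rw [key]

theorem cocycle_mul_inv_symm (hα : IsCocycle α) (hnorm : IsNormalized α) (h : G) :
    α h h⁻¹ = α h⁻¹ h := by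
  simpa [(hnorm h).1, (hnorm h).2] using (hα h h⁻¹ h).symm

theorem Rmul_inv_Rmul (hα : IsCocycle α) (hnorm : IsNormalized α) (h : G) (v : G → k) :
    (((α h h⁻¹)⁻¹ : kˣ) : k) • Rmul α h⁻¹ (Rmul α h v) = v := by
  rw [Rmul_Rmul hα, mul_inv_cancel, Rmul_one hnorm, smul_smul, Units.inv_mul, one_smul]

theorem Rmul_Rmul_inv (hα : IsCocycle α) (hnorm : IsNormalized α) (h : G) (v : G → k) :
    Rmul α h ((((α h h⁻¹)⁻¹ : kˣ) : k) • Rmul α h⁻¹ v) = v := by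
  rw [map_smul, Rmul_Rmul hα, inv_mul_cancel, Rmul_one hnorm, cocycle_mul_inv_symm hα hnorm,
    smul_smul, Units.inv_mul, one_smul]

theorem rmuls_cons (g : G) (l : List G) (v : G → k) :
    rmuls α (g :: l) v = rmuls α l (Rmul α g v) := rfl

theorem rmuls_add (l : List G) (v w : G → k) :
    rmuls α l (v + w) = rmuls α l v + rmuls α l w := by
  induction l generalizing v w with
  | nil => rfl
  | cons g l ih => simp only [rmuls_cons, map_add, ih]

theorem rmuls_smul (l : List G) (c : k) (v : G → k) :
    rmuls α l (c • v) = c • rmuls α l v := by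
  induction l generalizing v with
  | nil => rfl
  | cons g l ih => simp only [rmuls_cons, map_smul, ih]

theorem rinvs_rmuls (hα : IsCocycle α) (hnorm : IsNormalized α) (l : List G) (v : G → k) :
    rinvs α l (rmuls α l v) = v := by
  induction l generalizing v with
  | nil => rfl
  | cons g l ih =>
    rw [rmuls_cons, rinvs, List.foldr_cons, ← rinvs, ih, Rmul_inv_Rmul hα hnorm]

theorem rmuls_rinvs (hα : IsCocycle α) (hnorm : IsNormalized α) (l : List G) (v : G → k) :
    rmuls α l (rinvs α l v) = v := by
  induction l with
  | nil => rfl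
  | cons g l ih =>
    rw [rmuls_cons, rinvs, List.foldr_cons, ← rinvs, Rmul_Rmul_inv hα hnorm, ih]

/-- Right multiplication by `ḡ₁·…·ḡₙ` as an automorphism of the `k`-module `k_αG`. -/
def rmulsEquiv (hα : IsCocycle α) (hnorm : IsNormalized α) (l : List G) :
    (G → k) ≃ₗ[k] (G → k) where
  toFun := rmuls α l
  map_add' := rmuls_add l
  map_smul' := rmuls_smul l
  invFun := rinvs α l
  left_inv := rinvs_rmuls hα hnorm l
  right_inv := rmuls_rinvs hα hnorm l

theorem Lmul_rmuls (hα : IsCocycle α) (g : G) (l : List G) (v : G → k) :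
    Lmul α g (rmuls α l v) = rmuls α l (Lmul α g v) := by
  induction l generalizing v with
  | nil => rfl
  | cons h l ih => rw [rmuls_cons, ih, Lmul_Rmul hα, rmuls_cons]

theorem rmuls_ofFn_succ {n : ℕ} (g : Fin (n + 1) → G) (v : G → k) :
    rmuls α (List.ofFn g) v = rmuls α (List.ofFn fun i => g i.succ) (Rmul α (g 0) v) := by
  rw [List.ofFn_succ, rmuls_cons]

theorem rmuls_ofFn_castSucc {n : ℕ} (g : Fin (n + 1) → G) (v : G → k) :
    rmuls α (List.ofFn g) v
      = Rmul α (g (Fin.last n)) (rmuls α (List.ofFn fun i => g i.castSucc) v) := by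
  rw [List.ofFn_succ', List.concat_eq_append, rmuls, List.foldl_append]
  rfl

theorem mergeAt_zero_zero {n : ℕ} (g : Fin (n + 2) → G) : mergeAt g 0 0 = g 0 * g 1 := by
  simp [mergeAt]

theorem mergeAt_zero_succ {n : ℕ} (g : Fin (n + 2) → G) (i : Fin n) :
    mergeAt g 0 i.succ = g i.succ.succ := by
  simp [mergeAt]

theorem mergeAt_succ_zero {n : ℕ} (g : Fin (n + 2) → G) (j : Fin n) :
    mergeAt g j.succ 0 = g 0 := by
  simp [mergeAt]

theorem mergeAt_succ_succ {n : ℕ} (g : Fin (n + 2) → G) (j i : Fin n) :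
    mergeAt g j.succ i.succ = mergeAt (fun l => g l.succ) j i := by
  simp [mergeAt]

theorem rmuls_ofFn_mergeAt (hα : IsCocycle α) {n : ℕ} (g : Fin (n + 1) → G) (j : Fin n)
    (v : G → k) :
    rmuls α (List.ofFn g) v
      = (α (g j.castSucc) (g j.succ) : k) • rmuls α (List.ofFn (mergeAt g j)) v := by
  induction n generalizing v with
  | zero => exact j.elim0
  | succ n ih =>
    rw [rmuls_ofFn_succ g, rmuls_ofFn_succ (mergeAt g j)]
    cases j using Fin.cases with
    | zero =>
      simp only [rmuls_ofFn_succ (fun i => g i.succ), mergeAt_zero_zero, mergeAt_zero_succ,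
        ← rmuls_smul]
      rw [Rmul_Rmul hα]
      rfl
    | succ j =>
      simp only [mergeAt_succ_zero, mergeAt_succ_succ]
      exact ih _ j _

theorem rinvs_ofFn_mergeAt (hα : IsCocycle α) (hnorm : IsNormalized α) {n : ℕ}
    (g : Fin (n + 1) → G) (j : Fin n) (v : G → k) :
    rinvs α (List.ofFn g) ((α (g j.castSucc) (g j.succ) : k) • v)
      = rinvs α (List.ofFn (mergeAt g j)) v := by
  obtain ⟨w, rfl⟩ := (rmulsEquiv hα hnorm (List.ofFn (mergeAt g j))).surjective v
  change rinvs α _ (_ • rmuls α _ w) = rinvs α _ (rmuls α _ w)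
  rw [← rmuls_ofFn_mergeAt hα, rinvs_rmuls hα hnorm, rinvs_rmuls hα hnorm]

theorem rinvs_ofFn_Rmul_last (hα : IsCocycle α) (hnorm : IsNormalized α) {n : ℕ}
    (g : Fin (n + 1) → G) (v : G → k) :
    rinvs α (List.ofFn g) (Rmul α (g (Fin.last n)) v)
      = rinvs α (List.ofFn fun i => g i.castSucc) v := by
  obtain ⟨w, rfl⟩ := (rmulsEquiv hα hnorm (List.ofFn fun i => g i.castSucc)).surjective v
  change rinvs α _ (Rmul α _ (rmuls α _ w)) = rinvs α _ (rmuls α _ w)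
  rw [← rmuls_ofFn_castSucc, rinvs_rmuls hα hnorm, rinvs_rmuls hα hnorm]

theorem rinvs_ofFn_Lmul_zero (hα : IsCocycle α) (hnorm : IsNormalized α) {n : ℕ}
    (g : Fin (n + 1) → G) (v : G → k) :
    rinvs α (List.ofFn g) (Lmul α (g 0) v)
      = (((α (g 0) (g 0)⁻¹)⁻¹ : kˣ) : k) •
          Rmul α (g 0)⁻¹ (Lmul α (g 0) (rinvs α (List.ofFn fun i => g i.succ) v)) := by
  obtain ⟨w, rfl⟩ := (rmulsEquiv hα hnorm (List.ofFn fun i => g i.succ)).surjective v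
  change rinvs α _ (Lmul α _ (rmuls α _ w)) = _ • Rmul α _ (Lmul α _ (rinvs α _ (rmuls α _ w)))
  rw [rinvs_rmuls hα hnorm, Lmul_rmuls hα, List.ofFn_succ, rinvs, List.foldr_cons, ← rinvs,
    rinvs_rmuls hα hnorm]

theorem conj_apply_of_commute (hα : IsCocycle α) (hnorm : IsNormalized α) {x h : G}
    (hx : h * x = x * h) (v : G → k) :
    ((((α h h⁻¹)⁻¹ : kˣ) : k) • Rmul α h⁻¹ (Lmul α h v)) x = chi α x h * v x := by
  have hy : h⁻¹ * (x * h) = x := by rw [← hx, inv_mul_cancel_left]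
  have key : (α h h⁻¹)⁻¹ * α (x * h) h⁻¹ = (α x h)⁻¹ := by
    have := hα x h h⁻¹
    rw [mul_inv_cancel, (hnorm x).2, one_mul] at this
    rw [this, mul_inv_rev, inv_mul_cancel_right]
  have key' := congrArg Units.val key
  rw [Units.val_mul] at key'
  simp only [Rmul, Lmul, LinearMap.coe_mk, AddHom.coe_mk, Pi.smul_apply, smul_eq_mul, inv_inv,
    hy, chi]
  rw [← key']
  ring

theorem Lmul_single [DecidableEq G] {x g : G} (hx : g * x = x * g) :
    Lmul α g (Pi.single x (1 : k)) = chi α x g • Rmul α g (Pi.single x 1) := by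
  funext y
  simp only [Rmul, Lmul, LinearMap.coe_mk, AddHom.coe_mk, Pi.smul_apply, smul_eq_mul, chi,
    Pi.single_apply, inv_mul_eq_iff_eq_mul, mul_inv_eq_iff_eq_mul, hx]
  split_ifs with hy
  · subst hy
    rw [mul_inv_cancel_right, ← hx, inv_mul_cancel_left]
    simp [mul_assoc]
  · simp

/-- The maps `π^n` commute with the differentials. -/
theorem cDiff_piC (hα : IsCocycle α) (hnorm : IsNormalized α) (x : G) {n : ℕ}
    (φ : (Fin n → G) → (G → k)) :
    cDiff (fun h : Subgroup.centralizer ({x} : Set G) => chi α x (h : G)) (piC α x φ)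
      = piC α x (hDiff α (Lmul α) (Rmul α) φ) := by
  funext h
  have hcomm : (h 0 : G) * x = x * h 0 :=
    (Subgroup.mem_centralizer_singleton_iff.mp (h 0).2)
  have hmerge (j : Fin n) :
      (fun i => Subtype.val (mergeAt h j i)) = mergeAt (fun i => (h i : G)) j := by
    funext i
    simp only [mergeAt]
    split_ifs <;> rfl
  have hlin (v : G → k) : rinvs α (List.ofFn fun i => (h i : G)) v
      = (rmulsEquiv hα hnorm (List.ofFn fun i => (h i : G))).symm v := rfl
  simp only [piC, cDiff, hDiff, hmerge]
  rw [hlin]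
  simp only [map_add, map_sum, map_zsmul, Pi.add_apply, Finset.sum_apply, Pi.smul_apply]
  simp only [← hlin]
  congr 1
  · congr 1
    · rw [rinvs_ofFn_Lmul_zero hα hnorm (fun i => (h i : G)),
        conj_apply_of_commute hα hnorm hcomm]
    · refine Finset.sum_congr rfl fun j _ => ?_
      rw [rinvs_ofFn_mergeAt hα hnorm (fun i => (h i : G))]
  · rw [rinvs_ofFn_Rmul_last hα hnorm (fun i => (h i : G))]

/-- The maps `ν^n` commute with the differentials. -/
theorem hDiff_nuZ [DecidableEq G] (hα : IsCocycle α) {x : G} (hx : x ∈ Subgroup.center G)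
    {n : ℕ} (ψ : (Fin n → G) → k) :
    hDiff α (Lmul α) (Rmul α) (nuZ α x ψ) = nuZ α x (cDiff (chi α x) ψ) := by
  funext g
  simp only [nuZ, cDiff, hDiff, add_smul, Finset.sum_smul, map_smul, smul_assoc]
  congr 1
  · congr 1
    · rw [Lmul_rmuls hα, Lmul_single (Subgroup.mem_center_iff.mp hx _), rmuls_smul,
        ← rmuls_ofFn_succ, smul_smul, mul_comm]
    · refine Finset.sum_congr rfl fun j _ => ?_
      rw [rmuls_ofFn_mergeAt hα g j, smul_comm (ψ _)]
  · rw [rmuls_ofFn_castSucc]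

theorem piC_zero (hα : IsCocycle α) (hnorm : IsNormalized α) (x : G) {n : ℕ} :
    piC α x (0 : (Fin n → G) → (G → k)) = 0 := by
  funext h
  exact congrFun (map_zero (rmulsEquiv hα hnorm (List.ofFn fun i => (h i : G))).symm) x

theorem nuZ_zero [DecidableEq G] (x : G) {n : ℕ} : nuZ α x (0 : (Fin n → G) → k) = 0 := by
  funext g
  simp [nuZ]

end ChainMaps

/-- (a) for every `x ∈ G`, `π^n_{G,x,α}` maps Hochschild cocycles to
group cocycles and Hochschild coboundaries to group coboundaries, hence induces a
well-defined map `HH^n(k_αG) → H^n(C_G(x), k x̄)`; (b) for every `x ∈ Z(G)`,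
`ν^n_{G,x,α}` maps group cocycles to Hochschild cocycles and group coboundaries to
Hochschild coboundaries, hence induces a well-defined map
`H^n(G, k x̄) → HH^n(k_αG)`. -/
theorem pi_nu_induce_cohomology_maps
    {k : Type*} [Field k] {G : Type*} [Group G] [Fintype G] [DecidableEq G]
    (α : G → G → kˣ) (hα : IsCocycle α) (hnorm : IsNormalized α) {n : ℕ} :
    (∀ x : G,
      (∀ φ : (Fin n → G) → (G → k), hDiff α (Lmul α) (Rmul α) φ = 0 →
        cDiff (fun h : Subgroup.centralizer ({x} : Set G) => chi α x (h : G))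
          (piC α x φ) = 0) ∧
      (∀ φ : (Fin n → G) → (G → k), IsHCoboundary α (Lmul α) (Rmul α) φ →
        IsCCoboundary (fun h : Subgroup.centralizer ({x} : Set G) => chi α x (h : G))
          (piC α x φ))) ∧
    (∀ x ∈ Subgroup.center G,
      (∀ ψ : (Fin n → G) → k, cDiff (chi α x) ψ = 0 →
        hDiff α (Lmul α) (Rmul α) (nuZ α x ψ) = 0) ∧
      (∀ ψ : (Fin n → G) → k, IsCCoboundary (chi α x) ψ →
        IsHCoboundary α (Lmul α) (Rmul α) (nuZ α x ψ))) := by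
  refine ⟨fun x => ⟨fun φ hφ => ?_, fun φ hφ => ?_⟩, fun x hx => ⟨fun ψ hψ => ?_, fun ψ hψ => ?_⟩⟩
  · rw [cDiff_piC hα hnorm, hφ, piC_zero hα hnorm]
  · cases n with
    | zero =>
      obtain rfl : φ = 0 := hφ
      exact piC_zero hα hnorm x
    | succ n =>
      obtain ⟨θ, rfl⟩ := hφ
      exact ⟨piC α x θ, (cDiff_piC hα hnorm x θ).symm⟩
  · rw [hDiff_nuZ hα hx, hψ, nuZ_zero]
  · cases n with
    | zero =>
      obtain rfl : ψ = 0 := hψ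
      exact nuZ_zero x
    | succ n =>
      obtain ⟨θ, rfl⟩ := hψ
      exact ⟨nuZ α x θ, (hDiff_nuZ hα hx θ).symm⟩

end TwistedSym
end

section
/- Let n ≥ 0, x ∈ G, and ψ ∈ C^n(C_G(x), kx). Then ν^n_{G,x}(τψ) = τ·(ν^n_{G,x}(ψ)) for every τ ∈ Σ_{n+1}, where Σ_{n+1} acts on C^n(C_G(x), kx) by Staic's action and on C^n(kG,kG) by the symmetric Hochschild action; equivalently, ν^n_{G,x}(σ_i ψ) = σ_i(ν^n_{G,x}(ψ)) for each transposition σ_i = (i,i+1), 1 ≤ i ≤ n. -/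
/- Common setup: twisted group algebras modelled on their canonical basis.
An element of the twisted group algebra `k_αG` is modelled as a function `G → k`
(its coordinates in the basis `{ḡ : g ∈ G}`), and a Hochschild `n`-cochain
`Hom_k((k_αG)^{⊗n}, M)` is modelled by its values on basis tensors, i.e. as a
function `(Fin n → G) → M`.  Similarly a group cochain `C^n(H, A)` is a function
`(Fin n → H) → A`; the one-dimensional module `k x̄` is modelled as `k` with the
action of `h` given by multiplication by the character `χ(h) = α(h,x)·α(x,h)⁻¹`. -/

namespace TwistedSym

section Equivariance

/-- The tuple of successive quotients `aᵢ⁻¹ aᵢ₊₁` of a sequence: the passage from homogeneous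
to inhomogeneous coordinates. -/
def quotientTuple {H : Type*} [Group H] (n : ℕ) (a : ℕ → H) : Fin n → H :=
  fun i => (a i)⁻¹ * a (i + 1)

/-- In homogeneous coordinates, `swapTuple` is a permutation of the coordinates. -/
theorem swapTuple_quotientTuple {H : Type*} [Group H] {n : ℕ} (i0 : Fin n) (a : ℕ → H) :
    swapTuple i0 (quotientTuple n a) =
      quotientTuple n (a ∘ Equiv.swap (i0 : ℕ) (i0 + 1)) := by
  funext j
  simp only [swapTuple, quotientTuple, Function.comp, Fin.ext_iff]
  split_ifs with h1 h2 h3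
  · rw [Equiv.swap_apply_of_ne_of_ne (by omega) (by omega), h1, Equiv.swap_apply_left]
    group
  · rw [h2, Equiv.swap_apply_left, Equiv.swap_apply_right]
    group
  · rw [h3, Equiv.swap_apply_right,
      Equiv.swap_apply_of_ne_of_ne (a := (i0 : ℕ)) (x := (i0 : ℕ) + 1 + 1) (by omega) (by omega)]
    group
  · rw [Equiv.swap_apply_of_ne_of_ne (by omega) (by omega),
      Equiv.swap_apply_of_ne_of_ne (by omega) (by omega)]

theorem prod_take_ofFn_quotientTuple {H : Type*} [Group H] {n : ℕ} (a : ℕ → H) {i : ℕ}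
    (hi : i ≤ n) : ((List.ofFn (quotientTuple n a)).take i).prod = (a 0)⁻¹ * a i := by
  induction i with
  | zero => simp
  | succ i ih =>
    rw [List.prod_take_succ _ _ (by simpa using hi), ih (by omega)]
    simp [quotientTuple]

theorem quotientTuple_prod_take_ofFn {H : Type*} [Group H] {n : ℕ} (g : Fin n → H) :
    quotientTuple n (fun i => ((List.ofFn g).take i).prod) = g := by
  funext i
  simp only [quotientTuple]
  rw [List.prod_take_succ _ _ (by simp)]
  simp

theorem swapTuple_eq_quotientTuple {H : Type*} [Group H] {n : ℕ} (i0 : Fin n) (g : Fin n → H) :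
    swapTuple i0 g = quotientTuple n
      ((fun i => ((List.ofFn g).take i).prod) ∘ Equiv.swap (i0 : ℕ) (i0 + 1)) := by
  rw [← swapTuple_quotientTuple, quotientTuple_prod_take_ofFn]

/-- The homogeneous coordinate `0` after the transposition. -/
theorem prod_take_ofFn_swap_zero {H : Type*} [Group H] {n : ℕ} (i0 : Fin n) (g : Fin n → H) :
    ((List.ofFn g).take (Equiv.swap (i0 : ℕ) (i0 + 1) 0)).prod =
      if (i0 : ℕ) = 0 then g i0 else 1 := by
  split_ifs with h
  · obtain ⟨i, hi⟩ := i0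
    obtain rfl : i = 0 := h
    rw [Equiv.swap_apply_left, List.prod_take_succ _ _ (by simpa using hi)]
    simp
  · rw [Equiv.swap_apply_of_ne_of_ne (by omega) (by omega)]
    simp

/-- The homogeneous coordinate `n` after the transposition. -/
theorem prod_take_ofFn_swap_last {H : Type*} [Group H] {n : ℕ} (i0 : Fin n) (g : Fin n → H) :
    ((List.ofFn g).take (Equiv.swap (i0 : ℕ) (i0 + 1) n)).prod *
      (if (i0 : ℕ) + 1 = n then g i0 else 1) = (List.ofFn g).prod := by
  have hlast : (List.ofFn g).prod = ((List.ofFn g).take n).prod := by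
    rw [List.take_of_length_le (by simp)]
  rw [hlast]
  split_ifs with h
  · have hs : Equiv.swap (i0 : ℕ) (i0 + 1) n = i0 := by
      simpa only [h] using Equiv.swap_apply_right (i0 : ℕ) (i0 + 1)
    have ht : ((List.ofFn g).take n).prod = ((List.ofFn g).take (i0 + 1)).prod := by rw [h]
    rw [hs, ht, List.prod_take_succ _ _ (by simp)]
    simp
  · rw [Equiv.swap_apply_of_ne_of_ne (by omega) (by omega), mul_one]

section Cosets

variable {G : Type*} [Group G] {K : Subgroup G} {m : ℕ} {γ : Fin m → G}
  {idx : Fin m → G → Fin m} {rep : Fin m → G → G}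

/-- The tuple `(h_{j,1}, …, h_{j,n})` of elements of `K` attached to `(g₁, …, gₙ)`. -/
def cosetTuple (hrep : ∀ j a, rep j a ∈ K) {n : ℕ} (idx : Fin m → G → Fin m) (j : Fin m)
    (g : Fin n → G) : Fin n → K :=
  fun i => ⟨rep (chainIdx idx j ((List.ofFn g).take (i : ℕ))) (g i), hrep _ _⟩

/-- There is a left `K`-equivariant retraction `κ : G → K` for which the homogeneous coordinates
of `cosetTuple` are the `κ (γⱼ g₁ ⋯ gᵢ)`. -/
theorem exists_cosetTuple_eq_quotientTuple (hrep : ∀ j a, rep j a ∈ K)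
    (hidx : ∀ j a, γ j * a = rep j a * γ (idx j a))
    (hcover : ∀ g : G, ∃! j : Fin m, g * (γ j)⁻¹ ∈ K) (n : ℕ) :
    ∃ κ : G → K, (∀ (c : K) (u : G), κ (c * u) = c * κ u) ∧
      ∀ (j : Fin m) (g : Fin n → G), cosetTuple hrep idx j g =
        quotientTuple n (fun i => κ (γ j * ((List.ofFn g).take i).prod)) := by
  choose s hs hs' using hcover
  simp only at hs hs'
  have hsmul : ∀ (c : K) (u : G), s (c * u) = s u := fun c u =>
    (hs' _ _ (by rw [mul_assoc]; exact K.mul_mem c.2 (hs u))).symm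
  have hsγ : ∀ j, s (γ j) = j := fun j => (hs' _ _ (by simp)).symm
  have hstep : ∀ j a b, s (γ j * (a * b)) = s (γ (idx j a) * b) := fun j a b => by
    rw [← mul_assoc, hidx, mul_assoc]
    exact hsmul ⟨_, hrep j a⟩ _
  have hchain : ∀ (l : List G) (j : Fin m), chainIdx idx j l = s (γ j * l.prod) := by
    intro l
    induction l with
    | nil => intro j; simp [chainIdx, hsγ]
    | cons a l ih => intro j; rw [chainIdx, ih, List.prod_cons, hstep]
  refine ⟨fun u => ⟨u * (γ (s u))⁻¹, hs u⟩, fun c u => ?_, fun j g => ?_⟩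
  · ext
    simp [hsmul, mul_assoc]
  · funext i
    ext
    have hidxs : ∀ u a, idx (s u) a = s (u * a) := fun u a => by
      have h := hsmul ⟨_, hs u⟩ (γ (s u) * a)
      have h2 := hstep (s u) a 1
      simp only [mul_one, hsγ] at h2
      rw [← h2, ← h]
      congr 1
      group
    have hrep_eq : ∀ j a, rep j a = γ j * a * (γ (idx j a))⁻¹ := fun j a => by
      rw [hidx]; group
    simp only [cosetTuple, quotientTuple, Subgroup.coe_mul, Subgroup.coe_inv]
    rw [List.prod_take_succ _ _ (by simp), hchain, hrep_eq, hidxs]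
    simp only [List.getElem_ofFn, Fin.eta]
    rw [← mul_assoc (γ j)]
    group

theorem cosetTuple_swapTuple (hrep : ∀ j a, rep j a ∈ K)
    (hidx : ∀ j a, γ j * a = rep j a * γ (idx j a))
    (hcover : ∀ g : G, ∃! j : Fin m, g * (γ j)⁻¹ ∈ K) {n : ℕ} (i0 : Fin n) (j : Fin m)
    (g : Fin n → G) :
    cosetTuple hrep idx j (swapTuple i0 g) = swapTuple i0
      (cosetTuple hrep idx (idx j (if (i0 : ℕ) = 0 then g i0 else 1)⁻¹) g) := by
  obtain ⟨κ, hκ, h⟩ := exists_cosetTuple_eq_quotientTuple hrep hidx hcover n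
  rw [h, h, swapTuple_quotientTuple, swapTuple_eq_quotientTuple]
  have key : ∀ i ≤ n, ((List.ofFn (quotientTuple n
      ((fun i => ((List.ofFn g).take i).prod) ∘ Equiv.swap (i0 : ℕ) (i0 + 1)))).take i).prod =
        (if (i0 : ℕ) = 0 then g i0 else 1)⁻¹ *
          ((List.ofFn g).take (Equiv.swap (i0 : ℕ) (i0 + 1) i)).prod := fun i hi => by
    rw [prod_take_ofFn_quotientTuple _ hi, ← prod_take_ofFn_swap_zero]
    rfl
  have hκr : ∀ (j : Fin m) (a u : G), κ (γ j * (a * u)) = ⟨_, hrep j a⟩ * κ (γ (idx j a) * u) :=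
    fun j a u => by rw [← hκ, ← mul_assoc, hidx, mul_assoc]
  funext i
  simp only [quotientTuple, Function.comp_apply] at key ⊢
  rw [key _ (by omega), key _ (by omega), hκr, hκr]
  group

theorem idx_bijective (hrep : ∀ j a, rep j a ∈ K)
    (hidx : ∀ j a, γ j * a = rep j a * γ (idx j a))
    (hcover : ∀ g : G, ∃! j : Fin m, g * (γ j)⁻¹ ∈ K) (a : G) :
    Function.Bijective fun j => idx j a := by
  refine Finite.injective_iff_bijective.mp fun i j hij => ?_
  refine (hcover (γ i)).unique (by simp) ?_
  have hij' : idx i a = idx j a := hij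
  have h : γ i * (γ j)⁻¹ = rep i a * (rep j a)⁻¹ := by
    rw [eq_mul_inv_of_mul_eq (hidx i a), eq_mul_inv_of_mul_eq (hidx j a), hij']
    group
  rw [h]
  exact K.mul_mem (hrep _ _) (K.inv_mem (hrep _ _))

end Cosets

section Untwisted

variable {k : Type*} [CommRing k] {G : Type*} [Group G]

theorem Lmul_one_single [DecidableEq G] (g y : G) :
    Lmul (k := k) (fun _ _ => 1) g (Pi.single y 1) = Pi.single (g * y) 1 := by
  funext z
  simp [Lmul, Pi.single_apply, inv_mul_eq_iff_eq_mul]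

theorem Rmul_one_single [DecidableEq G] (g y : G) :
    Rmul (k := k) (fun _ _ => 1) g (Pi.single y 1) = Pi.single (y * g) 1 := by
  funext z
  simp [Rmul, Pi.single_apply, mul_inv_eq_iff_eq_mul]

theorem hSigma_untwisted {n : ℕ} (i0 : Fin n) (φ : (Fin n → G) → (G → k)) (g : Fin n → G) :
    hSigma (fun _ _ => (1 : kˣ)) (Lmul fun _ _ => (1 : kˣ)) (Rmul fun _ _ => (1 : kˣ)) i0 φ g =
      -Lmul (fun _ _ => (1 : kˣ)) (if (i0 : ℕ) = 0 then g i0 else 1)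
        (Rmul (fun _ _ => (1 : kˣ)) (if (i0 : ℕ) + 1 = n then g i0 else 1)
          (φ (swapTuple i0 g))) := by
  have hL : ∀ v : G → k, Lmul (fun _ _ => (1 : kˣ)) 1 v = v := fun v => by
    funext y; simp [Lmul]
  have hR : ∀ v : G → k, Rmul (fun _ _ => (1 : kˣ)) 1 v = v := fun v => by
    funext y; simp [Rmul]
  simp only [hSigma]
  split_ifs <;> simp [hL, hR]

end Untwisted

end Equivariance

/-- for any `x ∈ G` and the ordinary group algebra `kG`, `ν^n_{G,x}`
is `Σ_{n+1}`-equivariant: it intertwines Staic's action on `C^n(C_G(x), kx)`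
(trivial coefficients) with the symmetric Hochschild action on `C^n(kG,kG)`
(it suffices to check this on the transpositions `σ_i`). -/
theorem nuT_equivariant
    {k : Type*} [CommRing k] {G : Type*} [Group G] [Fintype G] [DecidableEq G]
    (x : G) {m : ℕ} (γ : Fin m → G) (idx : Fin m → G → Fin m) (rep : Fin m → G → G)
    (hrep : ∀ j a, rep j a ∈ Subgroup.centralizer ({x} : Set G))
    (hm : 0 < m) (hγ1 : γ ⟨0, hm⟩ = 1)
    (hidx : ∀ j a, γ j * a = rep j a * γ (idx j a))
    (hcover : ∀ g : G, ∃! j : Fin m, g * (γ j)⁻¹ ∈ Subgroup.centralizer ({x} : Set G))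
    {n : ℕ} (ψ : (Fin n → Subgroup.centralizer ({x} : Set G)) → k) (i0 : Fin n) :
    nuT x γ idx rep hrep (cSigma (fun _ => (1 : k)) i0 ψ) =
      hSigma (fun _ _ => (1 : kˣ)) (Lmul fun _ _ => (1 : kˣ)) (Rmul fun _ _ => (1 : kˣ))
        i0 (nuT x γ idx rep hrep ψ) := by
  funext g
  set a : G := if (i0 : ℕ) = 0 then g i0 else 1 with ha
  set b : G := if (i0 : ℕ) + 1 = n then g i0 else 1 with hb
  have hprod : (List.ofFn (swapTuple i0 g)).prod * b = a⁻¹ * (List.ofFn g).prod := by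
    have h := prod_take_ofFn_quotientTuple (n := n)
      ((fun i => ((List.ofFn g).take i).prod) ∘ Equiv.swap (i0 : ℕ) (i0 + 1)) le_rfl
    rw [← swapTuple_eq_quotientTuple, List.take_of_length_le (by simp)] at h
    simp only [Function.comp_apply] at h
    rw [h, prod_take_ofFn_swap_zero, mul_assoc, prod_take_ofFn_swap_last]
  have hconj : ∀ j, (γ (idx j a⁻¹))⁻¹ * x * γ (idx j a⁻¹) = a * ((γ j)⁻¹ * x * γ j) * a⁻¹ := by
    intro j
    have hc : rep j a⁻¹ * x = x * rep j a⁻¹ :=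
      (Subgroup.mem_centralizer_iff.mp (hrep j a⁻¹) x rfl).symm
    have hγ : γ (idx j a⁻¹) = (rep j a⁻¹)⁻¹ * (γ j * a⁻¹) := by rw [hidx]; group
    have hx : rep j a⁻¹ * x * (rep j a⁻¹)⁻¹ = x := by rw [hc]; group
    calc _ = a * (γ j)⁻¹ * (rep j a⁻¹ * x * (rep j a⁻¹)⁻¹) * γ j * a⁻¹ := by rw [hγ]; group
      _ = _ := by rw [hx]; group
  rw [hSigma_untwisted, ← ha, ← hb]
  simp only [nuT, map_sum, map_smul, Rmul_one_single, Lmul_one_single]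
  rw [← (idx_bijective hrep hidx hcover a⁻¹).sum_comp, ← Finset.sum_neg_distrib]
  refine Finset.sum_congr rfl fun j _ => ?_
  have hpos : (γ (idx j a⁻¹))⁻¹ * x * γ (idx j a⁻¹) * (List.ofFn g).prod =
      a * ((γ j)⁻¹ * x * γ j * (List.ofFn (swapTuple i0 g)).prod * b) := by
    rw [hconj, mul_assoc _ _ b, hprod]
    group
  have htuple := cosetTuple_swapTuple hrep hidx hcover i0 j g
  rw [← ha] at htuple
  unfold cosetTuple at htuple
  rw [hpos, htuple, ← neg_smul]
  simp only [cSigma, one_mul, ite_self]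

end TwistedSym
end
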